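/- Let G = (S, A) be a unit matrix hypergraph with A ∈ ℝ^{m×n} and let w ∈ ℝ_{≥0}^m with W = diag(w). Define ‖x‖_{w+f} = sqrt((x^⊤ A^⊤ W A x + f_G(x))/2) and ‖x‖_{A^⊤WA} = sqrt(x^⊤ A^⊤ W A x). Then for all x, y ∈ ℝ^n with max{‖x‖_{w+f}, ‖y‖_{w+f}} ≤ 1: 1 − ‖(x+y)/2‖_{w+f} ≥ (1/16) · (‖x − y‖²_{A^⊤WA} + Σ_{i∈[k]} (g_i(x) − g_i(y))²). -/

import Mathlib

open Finset Matrix Real MeasureTheory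
open scoped Classical

/-- `gval A T x = max_{j ∈ T} |⟨a_j, x⟩|`, where `a_j` are the rows of `A`. -/
noncomputable def gval {m n : ℕ} (A : Matrix (Fin m) (Fin n) ℝ) (T : Finset (Fin m))
    (x : Fin n → ℝ) : ℝ :=
  if h : T.Nonempty then T.sup' h (fun j => |A j ⬝ᵥ x|) else 0

/-- The energy `f_G(x) = Σ_i max_{j ∈ S_i} ⟨a_j, x⟩²` of a unit matrix hypergraph. -/
noncomputable def energy {m n k : ℕ} (A : Matrix (Fin m) (Fin n) ℝ)
    (S : Fin k → Finset (Fin m)) (x : Fin n → ℝ) : ℝ :=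
  ∑ i, (gval A (S i) x) ^ 2

/-- The mixed norm `‖x‖_{w+f} = sqrt((xᵀ AᵀWA x + f_G(x))/2)`. -/
noncomputable def wfNorm {m n k : ℕ} (A : Matrix (Fin m) (Fin n) ℝ)
    (S : Fin k → Finset (Fin m)) (w : Fin m → ℝ) (x : Fin n → ℝ) : ℝ :=
  Real.sqrt ((x ⬝ᵥ ((Aᵀ * Matrix.diagonal w * A) *ᵥ x) + energy A S x) / 2)

theorem gval_nonneg {m n : ℕ} (A : Matrix (Fin m) (Fin n) ℝ) (T : Finset (Fin m))
    (x : Fin n → ℝ) : 0 ≤ gval A T x := by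
  unfold gval
  split_ifs with h
  · obtain ⟨j, hj⟩ := h
    exact (abs_nonneg _).trans (Finset.le_sup' (fun j => |A j ⬝ᵥ x|) hj)
  · exact le_rfl

theorem gval_midpoint_le {m n : ℕ} (A : Matrix (Fin m) (Fin n) ℝ) (T : Finset (Fin m))
    (x y : Fin n → ℝ) :
    gval A T ((2 : ℝ)⁻¹ • (x + y)) ≤ (gval A T x + gval A T y) / 2 := by
  unfold gval
  split_ifs with h
  · refine Finset.sup'_le h _ fun j hj => ?_
    have hx := Finset.le_sup' (fun j => |A j ⬝ᵥ x|) hj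
    have hy := Finset.le_sup' (fun j => |A j ⬝ᵥ y|) hj
    have habs := abs_add_le (A j ⬝ᵥ x) (A j ⬝ᵥ y)
    rw [dotProduct_smul, dotProduct_add, smul_eq_mul, abs_mul,
      abs_of_pos (by norm_num : (0 : ℝ) < 2⁻¹)]
    linarith
  · simp

theorem energy_nonneg {m n k : ℕ} (A : Matrix (Fin m) (Fin n) ℝ)
    (S : Fin k → Finset (Fin m)) (x : Fin n → ℝ) : 0 ≤ energy A S x :=
  Finset.sum_nonneg fun _ _ => sq_nonneg _

theorem energy_midpoint_le {m n k : ℕ} (A : Matrix (Fin m) (Fin n) ℝ)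
    (S : Fin k → Finset (Fin m)) (x y : Fin n → ℝ) :
    energy A S ((2 : ℝ)⁻¹ • (x + y)) ≤ (energy A S x + energy A S y) / 2 -
      (∑ i, (gval A (S i) x - gval A (S i) y) ^ 2) / 4 := by
  unfold energy
  rw [← Finset.sum_add_distrib, Finset.sum_div, Finset.sum_div, ← Finset.sum_sub_distrib]
  refine Finset.sum_le_sum fun i _ => ?_
  have h := pow_le_pow_left₀ (gval_nonneg A (S i) _) (gval_midpoint_le A (S i) x y) 2
  linarith

theorem dotProduct_gram_mulVec {m n : ℕ} (A : Matrix (Fin m) (Fin n) ℝ) (w : Fin m → ℝ)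
    (x : Fin n → ℝ) :
    x ⬝ᵥ ((Aᵀ * Matrix.diagonal w * A) *ᵥ x) = ∑ j, w j * (A j ⬝ᵥ x) ^ 2 := by
  rw [← mulVec_mulVec, ← mulVec_mulVec, dotProduct_mulVec, vecMul_transpose]
  simp only [dotProduct, mulVec_diagonal]
  refine Finset.sum_congr rfl fun j _ => ?_
  simp only [mulVec, dotProduct]
  ring

theorem dotProduct_gram_midpoint {m n : ℕ} (A : Matrix (Fin m) (Fin n) ℝ) (w : Fin m → ℝ)
    (x y : Fin n → ℝ) :
    ((2 : ℝ)⁻¹ • (x + y)) ⬝ᵥ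
        ((Aᵀ * Matrix.diagonal w * A) *ᵥ ((2 : ℝ)⁻¹ • (x + y))) =
      (x ⬝ᵥ ((Aᵀ * Matrix.diagonal w * A) *ᵥ x) +
        y ⬝ᵥ ((Aᵀ * Matrix.diagonal w * A) *ᵥ y)) / 2 -
      ((x - y) ⬝ᵥ ((Aᵀ * Matrix.diagonal w * A) *ᵥ (x - y))) / 4 := by
  simp only [dotProduct_gram_mulVec]
  rw [← Finset.sum_add_distrib, Finset.sum_div, Finset.sum_div, ← Finset.sum_sub_distrib]
  refine Finset.sum_congr rfl fun j _ => ?_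
  rw [dotProduct_smul, dotProduct_add, dotProduct_sub, smul_eq_mul]
  ring

theorem stmt_16 {m n k : ℕ} (A : Matrix (Fin m) (Fin n) ℝ)
    (S : Fin k → Finset (Fin m))
    -- `S` is a partition of `[m]` into nonempty groups
    (hS : ∀ i, (S i).Nonempty)
    (hdisj : ∀ i j, i ≠ j → Disjoint (S i) (S j))
    (hcover : ∀ a : Fin m, ∃ i, a ∈ S i)
    (w : Fin m → ℝ) (hw : ∀ j, 0 ≤ w j)
    (x y : Fin n → ℝ)
    (hx : wfNorm A S w x ≤ 1) (hy : wfNorm A S w y ≤ 1) :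
    (1 / 16) * ((x - y) ⬝ᵥ ((Aᵀ * Matrix.diagonal w * A) *ᵥ (x - y)) +
        ∑ i, (gval A (S i) x - gval A (S i) y) ^ 2) ≤
      1 - wfNorm A S w ((2 : ℝ)⁻¹ • (x + y)) := by
  unfold wfNorm at *
  rw [Real.sqrt_le_one] at hx hy
  have hquad := dotProduct_gram_midpoint A w x y
  have henergy := energy_midpoint_le A S x y
  have hquad_nonneg : 0 ≤ ((2 : ℝ)⁻¹ • (x + y)) ⬝ᵥ
      ((Aᵀ * Matrix.diagonal w * A) *ᵥ ((2 : ℝ)⁻¹ • (x + y))) := by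
    rw [dotProduct_gram_mulVec]
    exact Finset.sum_nonneg fun j _ => mul_nonneg (hw j) (sq_nonneg _)
  have hr := div_nonneg (add_nonneg hquad_nonneg
    (energy_nonneg A S ((2 : ℝ)⁻¹ • (x + y)))) (zero_le_two (α := ℝ))
  have hsq := Real.sq_sqrt hr
  have hone := sq_nonneg (√((((2 : ℝ)⁻¹ • (x + y)) ⬝ᵥ
      ((Aᵀ * Matrix.diagonal w * A) *ᵥ ((2 : ℝ)⁻¹ • (x + y))) +
      energy A S ((2 : ℝ)⁻¹ • (x + y))) / 2) - 1)
  linarith
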